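/- Let p_n denote the n-th prime number. Then for every t with 0 < t < 1, p_{⌊tn⌋}/p_n → t as n → ∞; consequently the sequence of primes is asymptotically equidistributed modulo one, i.e. for all 0 ≤ α < β ≤ 1, (1/n)·#{r : 1 ≤ r ≤ n, α ≤ p_r/p_n ≤ β} → β − α as n → ∞. -/

import Mathlib

open Filter Finset

namespace PNTAux
open MeasureTheory Complex ArithmeticFunction

/-- normalised Chebyshev function -/
noncomputable def af (u : ℝ) : ℝ := Chebyshev.psi (Real.exp u) * Real.exp (-u)

lemma af_nonneg (u : ℝ) : 0 ≤ af u :=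
  mul_nonneg (Chebyshev.psi_nonneg _) (Real.exp_pos _).le

lemma af_le (u : ℝ) : af u ≤ Real.log 4 + 4 := by
  unfold af
  have h := Chebyshev.psi_le_const_mul_self (Real.exp_pos u).le
  calc _ ≤ ((Real.log 4 + 4) * Real.exp u) * Real.exp (-u) := by gcongr
    _ = _ := by rw [mul_assoc, ← Real.exp_add]; simp

lemma af_zero {u : ℝ} (hu : u ≤ 0) : af u = 0 := by
  unfold af
  rw [Chebyshev.psi_eq_zero_of_le_one (Real.exp_le_one_iff.2 hu), zero_mul]

lemma af_mono (u h : ℝ) (hh : 0 ≤ h) : af u ≤ af (u + h) * Real.exp h := by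
  unfold af
  have : Chebyshev.psi (Real.exp u) ≤ Chebyshev.psi (Real.exp (u + h)) :=
    Chebyshev.psi_mono (Real.exp_le_exp.2 (by linarith))
  rw [mul_assoc, ← Real.exp_add, show -(u + h) + h = -u by ring]
  gcongr

lemma af_meas : Measurable af := by
  unfold af
  exact (Chebyshev.psi_mono.measurable.comp Real.measurable_exp).mul
    (Real.measurable_exp.comp measurable_neg)

/-- continuous extension -/
noncomputable def Gf (z : ℂ) : ℂ :=
  (vonMangoldt.LFunctionResidueClassAux (1 : ZMod 1) (1 + z) - 1) / (1 + z)

lemma Gf_cont : ContinuousOn Gf {z | 0 ≤ z.re} := by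
  unfold Gf
  refine ContinuousOn.div (ContinuousOn.sub ?_ continuousOn_const) (by fun_prop) ?_
  · refine (vonMangoldt.continuousOn_LFunctionResidueClassAux (1 : ZMod 1)).comp
      (by fun_prop) ?_
    intro z hz
    simpa using hz
  · intro z hz h
    have := congrArg Complex.re h
    simp at this hz
    linarith

lemma Gf_eq {z : ℂ} (hz : 0 < z.re) :
    Gf z = LSeries (fun n => ((Λ n : ℝ) : ℂ)) (1 + z) / (1 + z) - 1 / z := by
  unfold Gf
  have h := vonMangoldt.eqOn_LFunctionResidueClassAux (q := 1) (a := 1) isUnit_one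
    (show (1 + z) ∈ {s : ℂ | 1 < s.re} by simpa using hz)
  have hL : LSeries (fun n => ((vonMangoldt.residueClass (1 : ZMod 1) n : ℝ) : ℂ)) (1 + z)
      = LSeries (fun n => ((Λ n : ℝ) : ℂ)) (1 + z) := by
    congr 1
    ext n
    simp [vonMangoldt.residueClass, Set.indicator, Subsingleton.elim (n : ZMod 1) 1]
  rw [h]
  simp only [hL]
  have h0 : z ≠ 0 := by rintro rfl; simp at hz
  have h1 : 1 + z ≠ 0 := by
    intro h
    have := congrArg Complex.re h
    simp at this; linarith
  simp
  field_simp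
  ring

lemma laplace_af {z : ℂ} (hz : 0 < z.re) :
    ∫ u in Set.Ioi (0:ℝ), (af u : ℂ) * cexp (-z * u) =
      LSeries (fun n => ((Λ n : ℝ) : ℂ)) (1 + z) / (1 + z) := by
  have h1 : 1 + z ≠ 0 := by
    intro h
    have := congrArg Complex.re h
    simp at this; linarith
  rw [LSeries_eq_mul_integral_of_nonneg (fun n => Λ n) (r := 1) (by norm_num)
    (by simpa using hz) ?_ (fun n => vonMangoldt_nonneg), mul_div_cancel_left₀ _ h1]
  · have him : Real.exp '' (Set.Ioi 0) = Set.Ioi 1 := by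
      ext y
      constructor
      · rintro ⟨x, hx, rfl⟩
        simpa using hx
      · intro hy
        exact ⟨Real.log y, Real.log_pos hy, Real.exp_log (by linarith [Set.mem_Ioi.1 hy])⟩
    rw [← him, integral_image_eq_integral_abs_deriv_smul measurableSet_Ioi
      (fun x _ => (Real.hasDerivAt_exp x).hasDerivWithinAt) Real.exp_injective.injOn]
    refine setIntegral_congr_fun measurableSet_Ioi fun u hu => ?_
    have hs : (∑ k ∈ Icc 1 ⌊Real.exp u⌋₊, ((Λ k : ℝ) : ℂ)) =
        (Chebyshev.psi (Real.exp u) : ℂ) := by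
      simp only [Chebyshev.psi]
      push_cast
      rfl
    simp only [hs, af]
    rw [abs_of_pos (Real.exp_pos u), real_smul]
    have : ((Real.exp u : ℝ) : ℂ) ^ (-(1 + z + 1)) = cexp (-(1 + z + 1) * u) := by
      rw [cpow_def_of_ne_zero (by simp), ← ofReal_log (Real.exp_pos u).le, Real.log_exp, mul_comm]
    rw [this]
    push_cast
    rw [mul_assoc, mul_left_comm (cexp (u : ℂ)), ← Complex.exp_add, ← Complex.exp_add]
    congr 2
    ring
  · refine Asymptotics.IsBigO.of_bound (Real.log 4 + 4) (Eventually.of_forall fun n => ?_)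
    have h := Chebyshev.psi_le_const_mul_self (x := n) (by positivity)
    have h0 := Chebyshev.psi_nonneg n
    simp only [Chebyshev.psi, Nat.floor_natCast] at h h0
    simp only [Real.rpow_one, Real.norm_natCast]
    change ‖∑ k ∈ Ioc 0 n, Λ k‖ ≤ _
    rw [Real.norm_of_nonneg h0]
    exact h

lemma intg_exp {z : ℂ} (hz : 0 < z.re) :
    IntegrableOn (fun u : ℝ => cexp (-z * u)) (Set.Ioi 0) :=
  integrableOn_exp_mul_complex_Ioi (by simpa using hz) 0

lemma intg_bdd_exp {z : ℂ} (hz : 0 < z.re) {b : ℝ → ℝ} (hb : Measurable b) {C : ℝ}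
    (hC : ∀ u, |b u| ≤ C) :
    IntegrableOn (fun u : ℝ => (b u : ℂ) * cexp (-z * u)) (Set.Ioi 0) := by
  refine Integrable.bdd_mul (c := C) (intg_exp hz) ?_ ?_
  · exact (Complex.measurable_ofReal.comp hb).aestronglyMeasurable
  · exact Eventually.of_forall fun u => by simpa using hC u

lemma laplace_B {z : ℂ} (hz : 0 < z.re) :
    ∫ u in Set.Ioi (0:ℝ), ((af u - 1 : ℝ) : ℂ) * cexp (-z * u) = Gf z := by
  have h0 : z ≠ 0 := by rintro rfl; simp at hz
  rw [Gf_eq hz, ← laplace_af hz]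
  have : ∫ u in Set.Ioi (0:ℝ), cexp (-z * u) = 1 / z := by
    rw [integral_exp_mul_complex_Ioi (by simpa using hz)]
    simp
  rw [← this, ← integral_sub (intg_bdd_exp hz af_meas (C := Real.log 4 + 4)
    (fun u => by rw [abs_of_nonneg (af_nonneg u)]; exact af_le u)) (intg_exp hz)]
  congr 1
  ext u
  push_cast
  ring
end PNTAux

namespace PNTAux
open MeasureTheory Complex ArithmeticFunction

/-- Fejer kernel -/
noncomputable def Kf (v : ℝ) : ℝ := if v = 0 then 1 else 2 * (1 - Real.cos v) / v ^ 2

lemma Kf_nonneg (v : ℝ) : 0 ≤ Kf v := by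
  unfold Kf
  split_ifs
  · norm_num
  · have := Real.cos_le_one v
    have : 0 ≤ 1 - Real.cos v := by linarith
    positivity

lemma Kf_meas : Measurable Kf := by
  unfold Kf
  exact Measurable.ite (measurableSet_singleton 0) measurable_const (by fun_prop)

lemma Kf_le (v : ℝ) : Kf v ≤ 8 * (1 + v ^ 2)⁻¹ := by
  unfold Kf
  split_ifs with h
  · subst h; norm_num
  · have hv : 0 < v ^ 2 := by positivity
    rw [← div_eq_mul_inv, div_le_div_iff₀ hv (by positivity)]
    have h1 := Real.one_sub_sq_div_two_le_cos (x := v)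
    have h2 := Real.neg_one_le_cos v
    nlinarith

lemma Kf_intg : Integrable Kf := by
  refine (integrable_inv_one_add_sq.const_mul 8).mono' Kf_meas.aestronglyMeasurable
    (Eventually.of_forall fun v => ?_)
  rw [Real.norm_of_nonneg (Kf_nonneg v)]
  exact Kf_le v

lemma Kf_pos : 0 < ∫ v, Kf v := by
  rw [integral_pos_iff_support_of_nonneg Kf_nonneg Kf_intg]
  have : Set.Ioo (0:ℝ) 1 ⊆ Function.support Kf := by
    intro v hv
    rw [Function.mem_support]
    have h0 : v ≠ 0 := hv.1.ne'
    rw [Kf, if_neg h0]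
    have hc : Real.cos v < 1 := by
      rw [← Real.cos_zero]
      refine Real.cos_lt_cos_of_nonneg_of_le_pi le_rfl ?_ hv.1
      linarith [hv.2, Real.pi_gt_three]
    have : 0 < 1 - Real.cos v := by linarith
    positivity
  refine lt_of_lt_of_le ?_ (measure_mono this)
  simp

lemma Kf_real (v : ℝ) : ∫ y in (0:ℝ)..1, (2 * (1 - y) * Real.cos (y * v)) = Kf v := by
  unfold Kf
  split_ifs with h
  · subst h
    have : ∀ y ∈ Set.uIcc (0:ℝ) 1, HasDerivAt (fun y : ℝ => 2 * y - y ^ 2)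
        (2 * (1 - y) * Real.cos (y * 0)) y := by
      intro y _
      have := ((hasDerivAt_id y).const_mul 2).sub (hasDerivAt_pow 2 y)
      convert! this using 1
      simp; ring
    rw [intervalIntegral.integral_eq_sub_of_hasDerivAt this
      (Continuous.intervalIntegrable (by fun_prop) _ _)]
    norm_num
  · have : ∀ y ∈ Set.uIcc (0:ℝ) 1, HasDerivAt
        (fun y : ℝ => 2 * (1 - y) * Real.sin (y * v) / v - 2 * Real.cos (y * v) / v ^ 2)
        (2 * (1 - y) * Real.cos (y * v)) y := by
      intro y _
      have hyv : HasDerivAt (fun y : ℝ => y * v) v y := by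
        simpa using (hasDerivAt_id y).mul_const v
      have h1 : HasDerivAt (fun y : ℝ => 2 * (1 - y)) (-2) y := by
        have := ((hasDerivAt_id y).const_sub 1).const_mul 2
        convert! this using 1
        norm_num
      have h2 := ((h1.mul hyv.sin).div_const v).sub ((hyv.cos.const_mul 2).div_const (v ^ 2))
      convert! h2 using 1
      field_simp
      ring
    rw [intervalIntegral.integral_eq_sub_of_hasDerivAt this
      (Continuous.intervalIntegrable (by fun_prop) _ _)]
    simp
    field_simp
    ring

lemma Kf_complex (v : ℝ) :
    ∫ y in Set.Ioc (-1:ℝ) 1, (((1 - |y| : ℝ)) : ℂ) * cexp (I * y * v) = (Kf v : ℂ) := by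
  rw [← intervalIntegral.integral_of_le (by norm_num)]
  have hc : Continuous (fun y : ℝ => (((1 - |y| : ℝ)) : ℂ) * cexp (I * y * v)) := by fun_prop
  rw [← intervalIntegral.integral_add_adjacent_intervals (b := 0)
    (hc.intervalIntegrable _ _) (hc.intervalIntegrable _ _)]
  have h1 : ∫ y in (-1:ℝ)..0, (((1 - |y| : ℝ)) : ℂ) * cexp (I * y * v) =
      ∫ y in (0:ℝ)..1, (((1 - |y| : ℝ)) : ℂ) * cexp (-(I * y * v)) := by
    have := intervalIntegral.integral_comp_neg (a := (0:ℝ)) (b := 1)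
      (fun y : ℝ => (((1 - |y| : ℝ)) : ℂ) * cexp (I * y * v))
    simp only [neg_zero] at this
    rw [← this]
    congr 1; ext y
    simp
  rw [h1, ← intervalIntegral.integral_add (Continuous.intervalIntegrable (by fun_prop) _ _)
    (hc.intervalIntegrable _ _), ← Kf_real, ← intervalIntegral.integral_ofReal]
  refine intervalIntegral.integral_congr fun y hy => ?_
  simp only [Set.uIcc_of_le zero_le_one] at hy
  simp only [abs_of_nonneg hy.1]
  push_cast
  rw [Complex.cos, show (y:ℂ) * v * I = I * y * v by ring,
    show -((y:ℂ) * v) * I = -(I * y * v) by ring]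
  ring

lemma fubini_step {B : ℝ → ℝ} (hB : Measurable B) {C : ℝ} (hC : ∀ u, |B u| ≤ C) {G : ℂ → ℂ}
    (hG : ∀ z : ℂ, 0 < z.re → ∫ u in Set.Ioi (0:ℝ), (B u : ℂ) * cexp (-z * u) = G z)
    (l x : ℝ) {ε : ℝ} (hε : 0 < ε) :
    ∫ u in Set.Ioi (0:ℝ), (B u : ℂ) * cexp (-(ε:ℂ) * u) * (Kf (l * (x - u)) : ℂ) =
    ∫ y in Set.Ioc (-1:ℝ) 1, ((1 - |y| : ℝ) : ℂ) * cexp (I * y * (l * x)) * G (ε + I * (l * y)) := by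
  have hI : IntegrableOn (fun u : ℝ => (B u : ℂ) * cexp (-(ε:ℂ) * u)) (Set.Ioi 0) := by
    refine Integrable.bdd_mul (c := C) (integrableOn_exp_mul_complex_Ioi (by simpa using hε) 0) ?_ ?_
    · exact (Complex.measurable_ofReal.comp hB).aestronglyMeasurable
    · exact Eventually.of_forall fun u => by simpa using hC u
  have hφ : IntegrableOn (fun y : ℝ => ((1 - |y| : ℝ) : ℂ)) (Set.Ioc (-1) 1) :=
    (Continuous.integrableOn_Icc (by fun_prop)).mono_set Set.Ioc_subset_Icc_self
  have hP := hI.mul_prod hφ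
  have hP2 : Integrable (fun q : ℝ × ℝ => ((B q.1 : ℂ) * cexp (-(ε:ℂ) * q.1)) *
      (((1 - |q.2| : ℝ) : ℂ) * cexp (I * q.2 * (l * (x - q.1)))))
      ((volume.restrict (Set.Ioi 0)).prod (volume.restrict (Set.Ioc (-1) 1))) := by
    have := hP.bdd_mul (c := 1) (f := fun q : ℝ × ℝ => cexp (I * q.2 * (l * (x - q.1))))
      (Continuous.aestronglyMeasurable (by fun_prop))
      (Eventually.of_forall fun q => by
        have : I * q.2 * (l * (x - q.1)) = ((q.2 * (l * (x - q.1)) : ℝ) : ℂ) * I := by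
          push_cast; ring
        rw [this, Complex.norm_exp_ofReal_mul_I])
    refine this.congr (Eventually.of_forall fun q => ?_)
    simp only
    ring
  have hsw := integral_integral_swap (f := fun u y : ℝ => ((B u : ℂ) * cexp (-(ε:ℂ) * u)) *
      (((1 - |y| : ℝ) : ℂ) * cexp (I * y * (l * (x - u))))) hP2
  have e1 : ∀ u : ℝ, (B u : ℂ) * cexp (-(ε:ℂ) * u) * (Kf (l * (x - u)) : ℂ) =
      ∫ y in Set.Ioc (-1:ℝ) 1, ((B u : ℂ) * cexp (-(ε:ℂ) * u)) *
      (((1 - |y| : ℝ) : ℂ) * cexp (I * y * (l * (x - u)))) := by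
    intro u
    rw [integral_const_mul, ← Kf_complex]
    push_cast
    rfl
  simp_rw [e1]
  rw [hsw]
  congr 1
  ext y
  rw [← hG _ (by simpa using hε), ← integral_const_mul]
  congr 1
  ext u
  have : cexp (I * y * (l * (x - u))) = cexp (I * y * (l * x)) * cexp (-(I * (l * y)) * u) := by
    rw [← Complex.exp_add]; congr 1; ring
  rw [this]
  have : cexp (-(ε + I * (l * y)) * u) = cexp (-(ε:ℂ) * u) * cexp (-(I * (l * y)) * u) := by
    rw [← Complex.exp_add]; congr 1; ring
  rw [this]
  ring

lemma limit_step {B : ℝ → ℝ} (hB : Measurable B) {C : ℝ} (hC : ∀ u, |B u| ≤ C) {G : ℂ → ℂ}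
    (hGc : ContinuousOn G {z | 0 ≤ z.re})
    (hG : ∀ z : ℂ, 0 < z.re → ∫ u in Set.Ioi (0:ℝ), (B u : ℂ) * cexp (-z * u) = G z)
    {l : ℝ} (hl : 0 < l) (x : ℝ) :
    ∫ u in Set.Ioi (0:ℝ), (B u : ℂ) * (Kf (l * (x - u)) : ℂ) =
    ∫ y in Set.Ioc (-1:ℝ) 1, ((1 - |y| : ℝ) : ℂ) * cexp (I * y * (l * x)) * G (I * (l * y)) := by
  have hC0 : 0 ≤ C := (abs_nonneg _).trans (hC 0)
  have hK : Integrable (fun u => Kf (l * (x - u))) := by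
    have := (Kf_intg.comp_mul_left' hl.ne').comp_sub_left x
    exact this
  have t1 : Tendsto (fun ε : ℝ => ∫ u in Set.Ioi (0:ℝ),
      (B u : ℂ) * cexp (-(ε:ℂ) * u) * (Kf (l * (x - u)) : ℂ)) (nhdsWithin 0 (Set.Ioi 0))
      (nhds (∫ u in Set.Ioi (0:ℝ), (B u : ℂ) * (Kf (l * (x - u)) : ℂ))) := by
    refine tendsto_integral_filter_of_dominated_convergence (fun u => C * Kf (l * (x - u)))
      ?_ ?_ ((hK.const_mul C).integrableOn) ?_
    · refine Eventually.of_forall fun ε => Measurable.aestronglyMeasurable ?_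
      have := Kf_meas
      fun_prop
    · filter_upwards [self_mem_nhdsWithin] with ε hε
      filter_upwards [ae_restrict_mem measurableSet_Ioi] with u hu
      have hε' : 0 < ε := hε
      have hu' : 0 < u := hu
      rw [norm_mul, norm_mul, Complex.norm_exp]
      simp only [Complex.norm_real, Real.norm_eq_abs, abs_of_nonneg (Kf_nonneg _)]
      have h1 : Real.exp (-(ε:ℂ) * u).re ≤ 1 := by
        rw [Real.exp_le_one_iff]
        simp
        positivity
      have := hC u
      have hk := Kf_nonneg (l * (x - u))
      calc _ ≤ C * 1 * Kf (l * (x - u)) := by gcongr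
        _ = _ := by ring
    · refine Eventually.of_forall fun u => ?_
      have : ContinuousAt (fun ε : ℝ => (B u : ℂ) * cexp (-(ε:ℂ) * u) * (Kf (l * (x - u)) : ℂ)) 0 := by
        fun_prop
      have h := this.tendsto.mono_left (nhdsWithin_le_nhds (s := Set.Ioi 0))
      simpa using h
  have t2 : Tendsto (fun ε : ℝ => ∫ y in Set.Ioc (-1:ℝ) 1,
      ((1 - |y| : ℝ) : ℂ) * cexp (I * y * (l * x)) * G (ε + I * (l * y))) (nhdsWithin 0 (Set.Ioi 0))
      (nhds (∫ y in Set.Ioc (-1:ℝ) 1,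
        ((1 - |y| : ℝ) : ℂ) * cexp (I * y * (l * x)) * G (I * (l * y)))) := by
    have hcomp : IsCompact ((fun q : ℝ × ℝ => ((q.1:ℂ) + I * (l * q.2))) ''
        (Set.Icc 0 1 ×ˢ Set.Icc (-1) 1)) :=
      (isCompact_Icc.prod isCompact_Icc).image (by fun_prop)
    obtain ⟨D, hD⟩ := hcomp.exists_bound_of_continuousOn (f := G) (hGc.mono (by
      rintro _ ⟨q, hq, rfl⟩
      simpa using hq.1.1))
    have hGy : ∀ ε : ℝ, 0 ≤ ε → Continuous (fun y : ℝ => G (ε + I * (l * y))) := by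
      intro ε hε
      rw [← continuousOn_univ]
      exact hGc.comp (by fun_prop) (fun y _ => by simpa using hε)
    refine tendsto_integral_filter_of_dominated_convergence (fun _ => D) ?_ ?_ ?_ ?_
    · filter_upwards [self_mem_nhdsWithin] with ε hε
      have := hGy ε (le_of_lt hε)
      refine (Continuous.mul ?_ this).aestronglyMeasurable
      fun_prop
    · filter_upwards [Ioo_mem_nhdsGT (show (0:ℝ) < 1 by norm_num)] with ε hε
      filter_upwards [ae_restrict_mem measurableSet_Ioc] with y hy
      have hb := hD (ε + I * (l * y)) ⟨(ε, y), ⟨⟨hε.1.le, hε.2.le⟩, ⟨hy.1.le, hy.2⟩⟩, rfl⟩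
      rw [norm_mul, norm_mul]
      have h1 : I * y * (l * x) = ((y * (l * x) : ℝ) : ℂ) * I := by push_cast; ring
      rw [h1, Complex.norm_exp_ofReal_mul_I, Complex.norm_real, Real.norm_eq_abs]
      have h2 : abs (1 - |y|) ≤ 1 := by
        have := abs_nonneg y
        have : |y| ≤ 1 := abs_le.2 ⟨hy.1.le, hy.2⟩
        rw [abs_le]; constructor <;> linarith
      calc _ ≤ 1 * 1 * D := by gcongr
        _ = D := by ring
    · exact integrableOn_const (by simp)
    · filter_upwards with y
      refine Tendsto.const_mul _ ?_
      have hw : Tendsto G (nhdsWithin (I * (l * y)) {z | 0 ≤ z.re}) (nhds (G (I * (l * y)))) :=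
        hGc (I * (l * y)) (by simp)
      refine hw.comp (tendsto_nhdsWithin_iff.2 ⟨?_, ?_⟩)
      · have : ContinuousAt (fun ε : ℝ => (ε:ℂ) + I * (l * y)) 0 := by fun_prop
        have h := this.tendsto.mono_left (nhdsWithin_le_nhds (s := Set.Ioi 0))
        simpa using h
      · filter_upwards [self_mem_nhdsWithin] with ε hε
        simpa using le_of_lt hε
  refine tendsto_nhds_unique t1 (t2.congr' ?_)
  filter_upwards [self_mem_nhdsWithin] with ε hε
  exact (fubini_step hB hC hG l x hε).symm

lemma conv_tendsto {B : ℝ → ℝ} (hB : Measurable B) {C : ℝ} (hC : ∀ u, |B u| ≤ C) {G : ℂ → ℂ}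
    (hGc : ContinuousOn G {z | 0 ≤ z.re})
    (hG : ∀ z : ℂ, 0 < z.re → ∫ u in Set.Ioi (0:ℝ), (B u : ℂ) * cexp (-z * u) = G z)
    {l : ℝ} (hl : 0 < l) :
    Tendsto (fun x : ℝ => ∫ u in Set.Ioi (0:ℝ), B u * Kf (l * (x - u))) atTop (nhds 0) := by
  have hRL := Real.tendsto_integral_exp_smul_cocompact
    ((Set.Ioc (-1:ℝ) 1).indicator fun y : ℝ => ((1 - |y| : ℝ) : ℂ) * G (I * (l * y)))
  have hlin : Tendsto (fun x : ℝ => -(l * x / (2 * Real.pi))) atTop (cocompact ℝ) := by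
    refine Tendsto.mono_right ?_ atBot_le_cocompact
    refine tendsto_neg_atTop_atBot.comp ?_
    exact (tendsto_id.const_mul_atTop hl).atTop_div_const (by positivity)
  have h := hRL.comp hlin
  have h2 : Tendsto (fun x : ℝ => ((∫ u in Set.Ioi (0:ℝ), B u * Kf (l * (x - u)) : ℝ) : ℂ)) atTop
      (nhds 0) := by
    refine h.congr fun x => ?_
    rw [← integral_complex_ofReal]
    push_cast
    rw [limit_step hB hC hGc hG hl x, ← integral_indicator measurableSet_Ioc]
    simp only [Function.comp]
    congr 1
    ext y
    by_cases hy : y ∈ Set.Ioc (-1:ℝ) 1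
    · simp only [Set.indicator_of_mem hy]
      rw [Circle.smul_def, Real.fourierChar_apply, smul_eq_mul]
      have : ((2 * Real.pi * -(y * -(l * x / (2 * Real.pi))) : ℝ) : ℂ) * I = I * y * (l * x) := by
        have : (2 * Real.pi * -(y * -(l * x / (2 * Real.pi))) : ℝ) = y * (l * x) := by
          field_simp
        rw [this]; push_cast; ring
      rw [this]
      push_cast
      ring
    · simp only [Set.indicator_of_notMem hy, smul_zero]
  have h3 := (Complex.continuous_re.tendsto 0).comp h2
  simpa [Function.comp_def] using h3
end PNTAux

namespace PNTAux
open MeasureTheory Complex ArithmeticFunction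

lemma conv_af {l : ℝ} (hl : 0 < l) :
    Tendsto (fun x : ℝ => ∫ v, af (x - v / l) * Kf v) atTop (nhds (∫ v, Kf v)) := by
  have h := conv_tendsto (B := fun u => af u - 1) (C := Real.log 4 + 5) (G := Gf)
    (af_meas.sub_const 1) (fun u => by
      have h1 := af_nonneg u
      have h2 := af_le u
      have : 0 < Real.log 4 := Real.log_pos (by norm_num)
      rw [abs_le]; constructor <;> linarith) Gf_cont (fun z hz => laplace_B hz) hl
  have hK : ∀ x, Integrable (fun u => Kf (l * (x - u))) := fun x =>
    (Kf_intg.comp_mul_left' hl.ne').comp_sub_left x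
  have haK : ∀ x, Integrable (fun u => af u * Kf (l * (x - u))) := fun x =>
    (hK x).bdd_mul (c := Real.log 4 + 4) af_meas.aestronglyMeasurable
      (Eventually.of_forall fun u => by
        rw [Real.norm_of_nonneg (af_nonneg u)]; exact af_le u)
  -- change of variables
  have cv : ∀ (g : ℝ → ℝ) (x : ℝ), l * ∫ u, g u * Kf (l * (x - u)) =
      ∫ v, g (x - v / l) * Kf v := by
    intro g x
    have h1 := integral_sub_left_eq_self (fun u => g (x - u) * Kf (l * u)) volume x
    simp only [sub_sub_cancel] at h1
    rw [h1]
    have h2 := Measure.integral_comp_mul_left (fun v => g (x - v / l) * Kf v) l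
    simp only [mul_div_cancel_left₀ _ hl.ne'] at h2
    rw [h2, abs_of_pos (inv_pos.2 hl), smul_eq_mul, mul_inv_cancel_left₀ hl.ne']
  have e : ∀ x, l * ∫ u in Set.Ioi (0:ℝ), (af u - 1) * Kf (l * (x - u)) =
      (∫ v, af (x - v / l) * Kf v) -
        ∫ v, (Set.Ioi (0:ℝ)).indicator (fun _ => (1:ℝ)) (x - v / l) * Kf v := by
    intro x
    rw [← cv, ← cv, ← mul_sub]
    congr 1
    have e1 : ∫ u in Set.Ioi (0:ℝ), (af u - 1) * Kf (l * (x - u)) =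
        (∫ u in Set.Ioi (0:ℝ), af u * Kf (l * (x - u))) -
          ∫ u in Set.Ioi (0:ℝ), Kf (l * (x - u)) := by
      rw [← integral_sub (haK x).integrableOn (hK x).integrableOn]
      congr 1; ext u; ring
    rw [e1, ← integral_indicator measurableSet_Ioi, ← integral_indicator measurableSet_Ioi]
    congr 2
    · ext u
      by_cases hu : u ∈ Set.Ioi (0:ℝ)
      · rw [Set.indicator_of_mem hu]
      · rw [Set.indicator_of_notMem hu, af_zero (not_lt.1 hu), zero_mul]
    · ext u
      by_cases hu : u ∈ Set.Ioi (0:ℝ)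
      · rw [Set.indicator_of_mem hu, Set.indicator_of_mem hu, one_mul]
      · rw [Set.indicator_of_notMem hu, Set.indicator_of_notMem hu, zero_mul]
  have t1 : Tendsto (fun x : ℝ =>
      ∫ v, (Set.Ioi (0:ℝ)).indicator (fun _ => (1:ℝ)) (x - v / l) * Kf v) atTop
      (nhds (∫ v, Kf v)) := by
    refine tendsto_integral_filter_of_dominated_convergence Kf ?_ ?_ Kf_intg ?_
    · refine Eventually.of_forall fun x => Measurable.aestronglyMeasurable ?_
      refine Measurable.mul ?_ Kf_meas
      exact (measurable_const.indicator measurableSet_Ioi).comp (by fun_prop)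
    · refine Eventually.of_forall fun x => Eventually.of_forall fun v => ?_
      rw [norm_mul, Real.norm_of_nonneg (Kf_nonneg v)]
      have := norm_indicator_le_norm_self (s := Set.Ioi (0:ℝ)) (fun _ => (1:ℝ)) (x - v / l)
      rw [norm_one] at this
      exact mul_le_of_le_one_left (Kf_nonneg v) this
    · refine Eventually.of_forall fun v => ?_
      refine tendsto_const_nhds.congr' ?_
      filter_upwards [eventually_gt_atTop (v / l)] with x hx
      rw [Set.indicator_of_mem (by simpa using hx), one_mul]
  have := (h.const_mul l).add t1
  simp only [e, sub_add_cancel, mul_zero, zero_add] at this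
  exact this

/-- truncated mass -/
noncomputable def MR (R : ℝ) : ℝ := ∫ v in Set.Icc (-R) R, Kf v

lemma MR_tendsto : Tendsto MR atTop (nhds (∫ v, Kf v)) := by
  unfold MR
  have := (aecover_Icc (μ := (volume : Measure ℝ)) tendsto_neg_atTop_atBot
    tendsto_id).integral_tendsto_of_countably_generated Kf_intg
  simpa using this

lemma conv_intg (x l : ℝ) : Integrable (fun v => af (x - v / l) * Kf v) :=
  Kf_intg.bdd_mul (c := Real.log 4 + 4)
    ((af_meas.comp (by fun_prop : Measurable fun v : ℝ => x - v / l)).aestronglyMeasurable)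
    (Eventually.of_forall fun u => by
      rw [Real.norm_of_nonneg (af_nonneg _)]; exact af_le _)

lemma lower_conv {R δ : ℝ} (hR : 0 < R) (hδ : 0 < δ) (x : ℝ) :
    af x * Real.exp (-(2 * δ)) * MR R ≤ ∫ v, af (x + δ - v / (R / δ)) * Kf v := by
  have h1 := conv_intg (x + δ) (R / δ)
  have h2 : ∫ v in Set.Icc (-R) R, af (x + δ - v / (R / δ)) * Kf v ≤
      ∫ v, af (x + δ - v / (R / δ)) * Kf v :=
    setIntegral_le_integral h1 (Eventually.of_forall fun v =>
      mul_nonneg (af_nonneg _) (Kf_nonneg _))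
  refine le_trans ?_ h2
  unfold MR
  rw [← integral_const_mul]
  refine setIntegral_mono_on (Kf_intg.const_mul _).integrableOn h1.integrableOn
    measurableSet_Icc fun v hv => ?_
  refine mul_le_mul_of_nonneg_right ?_ (Kf_nonneg v)
  have hq : v / (R / δ) = δ * (v / R) := by field_simp
  have hle : v / R ≤ 1 := (div_le_one hR).2 hv.2
  have hge : -1 ≤ v / R := by rw [le_div_iff₀ hR]; linarith [hv.1]
  have hm := af_mono x (δ - v / (R / δ)) (by rw [hq]; nlinarith)
  rw [← add_sub_assoc] at hm
  have he : Real.exp (δ - v / (R / δ)) ≤ Real.exp (2 * δ) :=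
    Real.exp_le_exp.2 (by rw [hq]; nlinarith)
  calc af x * Real.exp (-(2 * δ))
      ≤ (af (x + δ - v / (R / δ)) * Real.exp (2 * δ)) * Real.exp (-(2 * δ)) := by
        gcongr
        exact hm.trans (mul_le_mul_of_nonneg_left he (af_nonneg _))
    _ = _ := by rw [mul_assoc, ← Real.exp_add]; simp

lemma upper_conv {R δ : ℝ} (hR : 0 < R) (hδ : 0 < δ) (x : ℝ) :
    ∫ v, af (x - δ - v / (R / δ)) * Kf v ≤
      af x * Real.exp (2 * δ) * MR R + (Real.log 4 + 4) * ((∫ v, Kf v) - MR R) := by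
  have h1 := conv_intg (x - δ) (R / δ)
  have hs := integral_add_compl (measurableSet_Icc (a := -R) (b := R)) h1
  have hs2 := integral_add_compl (measurableSet_Icc (a := -R) (b := R)) Kf_intg
  have hs3 : (∫ v, Kf v) - MR R = ∫ v in (Set.Icc (-R) R)ᶜ, Kf v := by
    unfold MR; linarith
  rw [hs3, ← hs]
  unfold MR
  rw [← integral_const_mul, ← integral_const_mul]
  refine add_le_add ?_ ?_
  · refine setIntegral_mono_on h1.integrableOn (Kf_intg.const_mul _).integrableOn
      measurableSet_Icc fun v hv => ?_
    refine mul_le_mul_of_nonneg_right ?_ (Kf_nonneg v)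
    have hq : v / (R / δ) = δ * (v / R) := by field_simp
    have hle : v / R ≤ 1 := (div_le_one hR).2 hv.2
    have hge : -1 ≤ v / R := by rw [le_div_iff₀ hR]; linarith [hv.1]
    have hm := af_mono (x - δ - v / (R / δ)) (δ + v / (R / δ)) (by rw [hq]; nlinarith)
    rw [show x - δ - v / (R / δ) + (δ + v / (R / δ)) = x by ring] at hm
    have he : Real.exp (δ + v / (R / δ)) ≤ Real.exp (2 * δ) :=
      Real.exp_le_exp.2 (by rw [hq]; nlinarith)
    exact hm.trans (mul_le_mul_of_nonneg_left he (af_nonneg _))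
  · refine setIntegral_mono_on h1.integrableOn (Kf_intg.const_mul _).integrableOn
      measurableSet_Icc.compl fun v hv => ?_
    exact mul_le_mul_of_nonneg_right (af_le _) (Kf_nonneg v)

lemma af_tendsto : Tendsto af atTop (nhds 1) := by
  set M := ∫ v, Kf v with hM
  have hMp : 0 < M := Kf_pos
  have tR : Tendsto (fun δ : ℝ => MR δ⁻¹) (nhdsWithin 0 (Set.Ioi 0)) (nhds M) :=
    MR_tendsto.comp tendsto_inv_nhdsGT_zero
  have tδ : Tendsto (fun δ : ℝ => δ) (nhdsWithin 0 (Set.Ioi 0)) (nhds 0) :=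
    tendsto_id.mono_left nhdsWithin_le_nhds
  have te : ∀ c : ℝ, Tendsto (fun δ : ℝ => Real.exp (c * δ)) (nhdsWithin 0 (Set.Ioi 0)) (nhds 1) := by
    intro c
    have : ContinuousAt (fun δ : ℝ => Real.exp (c * δ)) 0 := by fun_prop
    simpa using this.tendsto.mono_left (nhdsWithin_le_nhds (s := Set.Ioi 0))
  rw [tendsto_order]
  constructor
  · intro b hb
    -- b * e^{2δ} * MR + C (M - MR) < M - δ for small δ
    have t : Tendsto (fun δ : ℝ => b * Real.exp (2 * δ) * MR δ⁻¹ +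
        (Real.log 4 + 4) * (M - MR δ⁻¹) + δ) (nhdsWithin 0 (Set.Ioi 0)) (nhds (b * M)) := by
      have := ((((te 2).const_mul b).mul tR).add
        ((tendsto_const_nhds (x := M)).sub tR |>.const_mul (Real.log 4 + 4))).add tδ
      simpa using this
    have hlt : b * M < M := by nlinarith
    have hev := (t.eventually (gt_mem_nhds hlt)).and
      ((tR.eventually (lt_mem_nhds hMp)).and self_mem_nhdsWithin)
    obtain ⟨δ, h1, h2, h3⟩ := hev.exists
    have hδ : 0 < δ := h3
    have hc := (conv_af (l := δ⁻¹ / δ) (by positivity)).comp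
      (tendsto_atTop_add_const_right atTop (-δ) tendsto_id)
    filter_upwards [hc.eventually (lt_mem_nhds (show M - δ < M by linarith))] with x hx
    have hu := upper_conv (R := δ⁻¹) (by positivity) hδ x
    simp only [Function.comp, id, ← sub_eq_add_neg] at hx
    rw [← hM] at hu
    by_contra hcon
    have hp : 0 < Real.exp (2 * δ) := Real.exp_pos _
    have : af x * Real.exp (2 * δ) * MR δ⁻¹ ≤ b * Real.exp (2 * δ) * MR δ⁻¹ := by
      gcongr
      exact not_lt.1 hcon
    linarith
  · intro b hb
    have t : Tendsto (fun δ : ℝ => b * Real.exp (-2 * δ) * MR δ⁻¹ - δ)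
        (nhdsWithin 0 (Set.Ioi 0)) (nhds (b * M)) := by
      have := (((te (-2)).const_mul b).mul tR).sub tδ
      simpa using this
    have hlt : M < b * M := by nlinarith
    have hev := (t.eventually (lt_mem_nhds hlt)).and
      ((tR.eventually (lt_mem_nhds hMp)).and self_mem_nhdsWithin)
    obtain ⟨δ, h1, h2, h3⟩ := hev.exists
    have hδ : 0 < δ := h3
    have hc := (conv_af (l := δ⁻¹ / δ) (by positivity)).comp
      (tendsto_atTop_add_const_right atTop δ tendsto_id)
    filter_upwards [hc.eventually (gt_mem_nhds (show M < M + δ by linarith))] with x hx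
    have hu := lower_conv (R := δ⁻¹) (by positivity) hδ x
    simp only [Function.comp, id] at hx
    rw [show -(2 * δ) = -2 * δ by ring] at hu
    by_contra hcon
    have hp : 0 < Real.exp (-2 * δ) := Real.exp_pos _
    have : b * Real.exp (-2 * δ) * MR δ⁻¹ ≤ af x * Real.exp (-2 * δ) * MR δ⁻¹ := by
      gcongr
      exact not_lt.1 hcon
    linarith

lemma psi_tendsto : Tendsto (fun x : ℝ => Chebyshev.psi x / x) atTop (nhds 1) := by
  refine (af_tendsto.comp Real.tendsto_log_atTop).congr' ?_
  filter_upwards [eventually_gt_atTop 0] with x hx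
  simp only [Function.comp, af]
  rw [Real.exp_neg, Real.exp_log hx, div_eq_mul_inv]

lemma theta_tendsto : Tendsto (fun x : ℝ => Chebyshev.theta x / x) atTop (nhds 1) := by
  have h : Tendsto (fun x : ℝ => (Chebyshev.psi x - Chebyshev.theta x) / x) atTop (nhds 0) := by
    have h1 := Chebyshev.isBigO_psi_sub_theta_sqrt
    have h2 : (fun x : ℝ => √x) =o[atTop] (fun x : ℝ => x) := by
      have h3 : Tendsto (fun x : ℝ => (√x)⁻¹) atTop (nhds 0) :=
        tendsto_inv_atTop_zero.comp Real.tendsto_sqrt_atTop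
      refine Asymptotics.isLittleO_of_tendsto (fun x hx => by simp [hx]) (h3.congr fun x => ?_)
      rw [Real.sqrt_div_self]
    exact (h1.trans_isLittleO h2).tendsto_div_nhds_zero
  have := psi_tendsto.sub h
  simp only [sub_zero] at this
  refine this.congr fun x => ?_
  ring

lemma pi_tendsto : Tendsto (fun x : ℝ => (Nat.primeCounting ⌊x⌋₊ : ℝ) / (x / Real.log x)) atTop
    (nhds 1) := by
  have h := Chebyshev.integral_theta_div_log_sq_isLittleO.tendsto_div_nhds_zero
  have := theta_tendsto.add h
  simp only [add_zero] at this
  refine this.congr' ?_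
  filter_upwards [eventually_ge_atTop 2] with x hx
  rw [Chebyshev.primeCounting_eq_theta_div_log_add_integral hx]
  have : 0 < Real.log x := Real.log_pos (by linarith)
  have : 0 < x := by linarith
  field_simp

lemma pi_ratio {c : ℝ} (hc : 0 ≤ c) : Tendsto (fun x : ℝ =>
    (Nat.primeCounting ⌊c * x⌋₊ : ℝ) / (Nat.primeCounting ⌊x⌋₊ : ℝ)) atTop (nhds c) := by
  rcases hc.eq_or_lt with rfl | hc
  · simp
  have h1 := pi_tendsto.comp (tendsto_id.const_mul_atTop hc)
  have h2 := h1.div pi_tendsto one_ne_zero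
  have hl : Tendsto (fun x : ℝ => Real.log (c * x) / Real.log x) atTop (nhds 1) := by
    have : Tendsto (fun x : ℝ => Real.log c / Real.log x + 1) atTop (nhds (0 + 1)) :=
      (Real.tendsto_log_atTop.const_div_atTop _).add_const 1
    rw [zero_add] at this
    refine this.congr' ?_
    filter_upwards [eventually_gt_atTop 1] with x hx
    have : 0 < Real.log x := Real.log_pos hx
    rw [Real.log_mul hc.ne' (by linarith)]
    field_simp
  have h3 := (h2.mul (tendsto_const_nhds (x := c))).div hl one_ne_zero
  simp only [div_one, one_mul] at h3
  refine h3.congr' ?_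
  filter_upwards [eventually_gt_atTop 1, eventually_gt_atTop (1 / c)] with x hx hx2
  have l1 : 0 < Real.log x := Real.log_pos hx
  have l2 : 0 < Real.log (c * x) := Real.log_pos (by rwa [div_lt_iff₀' hc] at hx2)
  simp only [Pi.div_apply, Function.comp, id]
  have : 0 < x := by linarith
  field_simp
end PNTAux

namespace PNTAux

lemma nth_le_iff {r : ℕ} (hr : 1 ≤ r) {y : ℝ} (hy : 0 ≤ y) :
    (Nat.nth Nat.Prime (r - 1) : ℝ) ≤ y ↔ r ≤ Nat.primeCounting ⌊y⌋₊ := by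
  rw [← Nat.le_floor_iff hy, ← Nat.lt_succ_iff, ← not_le,
    ← Nat.count_le_iff_le_nth Nat.infinite_setOfPred_prime]
  unfold Nat.primeCounting Nat.primeCounting'
  change ¬ (Nat.count Nat.Prime (⌊y⌋₊ + 1) ≤ r - 1) ↔ r ≤ Nat.count Nat.Prime (⌊y⌋₊ + 1)
  omega

lemma pi_nth {n : ℕ} (hn : 1 ≤ n) : Nat.primeCounting (Nat.nth Nat.Prime (n - 1)) = n := by
  unfold Nat.primeCounting
  have h := Nat.primeCounting'_nth_eq (n - 1)
  unfold Nat.primeCounting' at *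
  rw [Nat.count_succ, h, if_pos (Nat.prime_nth_prime _)]
  omega

lemma nth_tendsto : Tendsto (fun n : ℕ => (Nat.nth Nat.Prime (n - 1) : ℝ)) atTop atTop := by
  refine tendsto_atTop_mono (fun n => ?_) tendsto_natCast_atTop_atTop
  have := Nat.add_two_le_nth_prime (n - 1)
  exact_mod_cast (by omega : n ≤ Nat.nth Nat.Prime (n - 1))

lemma pi_nth_ratio {c : ℝ} (hc : 0 ≤ c) : Tendsto (fun n : ℕ =>
    (Nat.primeCounting ⌊c * (Nat.nth Nat.Prime (n - 1) : ℝ)⌋₊ : ℝ) / n) atTop (nhds c) := by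
  refine ((pi_ratio hc).comp nth_tendsto).congr' ?_
  filter_upwards [eventually_ge_atTop 1] with n hn
  simp only [Function.comp, Nat.floor_natCast, pi_nth hn]

end PNTAux

/-- With `p n` the `n`-th prime (`p 1 = 2`), for every `0 < t < 1` we have
`p ⌊t*n⌋ / p n → t`, and consequently the sequence of primes is asymptotically
equidistributed modulo one. -/
theorem primes_asymptotically_equidistributed
    (p : ℕ → ℕ) (hp : ∀ n, p n = Nat.nth Nat.Prime (n - 1)) :
    (∀ t : ℝ, 0 < t → t < 1 →
      Tendsto (fun n : ℕ => (p ⌊t * (n : ℝ)⌋₊ : ℝ) / (p n : ℝ)) atTop (nhds t)) ∧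
    (∀ α β : ℝ, 0 ≤ α → α < β → β ≤ 1 →
      Tendsto (fun n : ℕ =>
          (((Finset.Icc 1 n).filter fun r =>
              α ≤ (p r : ℝ) / (p n : ℝ) ∧ (p r : ℝ) / (p n : ℝ) ≤ β).card : ℝ) / n)
        atTop (nhds (β - α))) := by
  have hpos : ∀ n, (0:ℝ) < p n := fun n => by
    rw [hp]; exact_mod_cast (Nat.prime_nth_prime _).pos
  have hle : ∀ r, 1 ≤ r → ∀ y : ℝ, 0 ≤ y → ((p r : ℝ) ≤ y ↔ r ≤ Nat.primeCounting ⌊y⌋₊) := by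
    intro r hr y hy
    rw [hp]; exact PNTAux.nth_le_iff hr hy
  have hpi : ∀ c : ℝ, 0 ≤ c → Tendsto (fun n : ℕ =>
      (Nat.primeCounting ⌊c * (p n : ℝ)⌋₊ : ℝ) / n) atTop (nhds c) := by
    intro c hc
    simp only [hp]
    exact PNTAux.pi_nth_ratio hc
  constructor
  · intro t ht0 ht1
    have hfl : Tendsto (fun n : ℕ => ⌊t * (n:ℝ)⌋₊) atTop atTop :=
      tendsto_nat_floor_atTop.comp (tendsto_natCast_atTop_atTop.const_mul_atTop ht0)
    rw [tendsto_order]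
    constructor
    · intro b hb
      rcases lt_or_ge b 0 with hb0 | hb0
      · exact Eventually.of_forall fun n => hb0.trans_le
          (div_nonneg (hpos _).le (hpos _).le)
      · obtain ⟨m, hbm, hmt⟩ := exists_between hb
        have hbig : Tendsto (fun n : ℕ => (t - m) * (n:ℝ)) atTop atTop :=
          tendsto_natCast_atTop_atTop.const_mul_atTop (by linarith)
        filter_upwards [(hpi b hb0).eventually (gt_mem_nhds hbm), eventually_ge_atTop 1,
          hfl.eventually_ge_atTop 1, hbig.eventually_gt_atTop 1] with n h1 h2 h3 h4
        rw [lt_div_iff₀ (hpos n), ← not_le, hle _ h3 _ (mul_nonneg hb0 (hpos n).le), not_le]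
        have hn : (0:ℝ) < n := by exact_mod_cast h2
        rw [div_lt_iff₀ hn] at h1
        have h5 := Nat.lt_floor_add_one (t * (n:ℝ))
        have : (Nat.primeCounting ⌊b * (p n : ℝ)⌋₊ : ℝ) < (⌊t * (n:ℝ)⌋₊ : ℝ) := by linarith
        exact_mod_cast this
    · intro b hb
      obtain ⟨m, htm, hmb⟩ := exists_between hb
      have hm0 : 0 ≤ m := by linarith
      filter_upwards [(hpi m hm0).eventually (lt_mem_nhds htm), eventually_ge_atTop 1,
          hfl.eventually_ge_atTop 1] with n h1 h2 h3
      refine lt_of_le_of_lt ?_ hmb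
      rw [div_le_iff₀ (hpos n), hle _ h3 _ (mul_nonneg hm0 (hpos n).le)]
      have hn : (0:ℝ) < n := by exact_mod_cast h2
      rw [lt_div_iff₀ hn] at h1
      have h5 := Nat.floor_le (show 0 ≤ t * (n:ℝ) by positivity)
      exact_mod_cast h5.trans h1.le
  · intro α β hα hαβ hβ
    have hβ0 : 0 ≤ β := by linarith
    have tl := (hpi β hβ0).sub (hpi α hα)
    have tu := tl.add tendsto_one_div_atTop_nhds_zero_nat
    rw [add_zero] at tu
    have key : ∀ n : ℕ, 1 ≤ n →
        Nat.primeCounting ⌊β * (p n : ℝ)⌋₊ - Nat.primeCounting ⌊α * (p n : ℝ)⌋₊ ≤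
          ((Finset.Icc 1 n).filter fun r =>
              α ≤ (p r : ℝ) / (p n : ℝ) ∧ (p r : ℝ) / (p n : ℝ) ≤ β).card ∧
        ((Finset.Icc 1 n).filter fun r =>
              α ≤ (p r : ℝ) / (p n : ℝ) ∧ (p r : ℝ) / (p n : ℝ) ≤ β).card ≤
          Nat.primeCounting ⌊β * (p n : ℝ)⌋₊ + 1 - Nat.primeCounting ⌊α * (p n : ℝ)⌋₊ := by
      intro n hn
      have hpn := hpos n
      have ha0 : 0 ≤ α * (p n : ℝ) := by positivity
      have hb0 : 0 ≤ β * (p n : ℝ) := by positivity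
      constructor
      · rw [← Nat.card_Ioc]
        refine Finset.card_le_card fun r hr => ?_
        rw [Finset.mem_Ioc] at hr
        have hr1 : 1 ≤ r := by omega
        have hb := (hle r hr1 _ hb0).2 hr.2
        have ha : α * (p n : ℝ) < p r := by
          rw [← not_le, hle r hr1 _ ha0]; omega
        rw [Finset.mem_filter, Finset.mem_Icc, le_div_iff₀ hpn, div_le_iff₀ hpn]
        refine ⟨⟨hr1, ?_⟩, ha.le, hb⟩
        have h1 : (p r : ℝ) ≤ p n := hb.trans (by nlinarith)
        rw [hle r hr1 _ hpn.le, Nat.floor_natCast, hp n, PNTAux.pi_nth hn] at h1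
        exact h1
      · rw [← Nat.card_Icc]
        refine Finset.card_le_card fun r hr => ?_
        rw [Finset.mem_filter, Finset.mem_Icc, le_div_iff₀ hpn, div_le_iff₀ hpn] at hr
        obtain ⟨⟨hr1, -⟩, ha, hb⟩ := hr
        rw [Finset.mem_Icc]
        refine ⟨?_, (hle r hr1 _ hb0).1 hb⟩
        by_contra hcon
        have h1 := ((hle (r + 1) (by omega) _ ha0).2 (by omega)).trans ha
        rw [hp, hp, Nat.cast_le, (Nat.nth_strictMono Nat.infinite_setOfPred_prime).le_iff_le] at h1
        omega
    refine tendsto_of_tendsto_of_tendsto_of_le_of_le' tl tu ?_ ?_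
    · filter_upwards [eventually_ge_atTop 1] with n hn
      have h := (key n hn).1
      rw [tsub_le_iff_right] at h
      have h' : (Nat.primeCounting ⌊β * (p n : ℝ)⌋₊ : ℝ) ≤ _ := Nat.cast_le.2 h
      rw [← sub_div]
      gcongr
      push_cast at h'
      linarith
    · filter_upwards [eventually_ge_atTop 1] with n hn
      have h := (key n hn).2
      have hm : Nat.primeCounting ⌊α * (p n : ℝ)⌋₊ ≤ Nat.primeCounting ⌊β * (p n : ℝ)⌋₊ :=
        Nat.monotone_primeCounting (Nat.floor_mono (by have := hpos n; gcongr))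
      have h2 := Nat.add_le_of_le_sub (by omega) h
      have h' := Nat.cast_le (α := ℝ).2 h2
      rw [← sub_div, ← add_div]
      gcongr
      push_cast at h'
      linarith
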